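/- Let t > 0 and let (k(n)) be an increasing sequence of positive integers with (n − k(n))/√n → t as n → ∞. For each n let C_i be the number of cycles of length i in a uniformly random permutation of {1,...,n} with exactly k(n) cycles. Then C_3 converges in distribution to a Poisson random variable with mean (4/3)t², and P(C_i = 0 for all i ≥ 4) → 1, i.e. with high probability all cycles other than those of length three have length one or two. -/

import Mathlib

open Finset Filter

/-- The number of cycles of a permutation, counting fixed points as cycles of length one. -/
def numCycles {n : ℕ} (σ : Equiv.Perm (Fin n)) : ℕ :=
  σ.cycleType.card + (Finset.univ.filter fun x => σ x = x).card

/-- `C_i`, the number of cycles of length `i` of a permutation (fixed points are the cycles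
of length one). -/
def cycleCount {n : ℕ} (σ : Equiv.Perm (Fin n)) (i : ℕ) : ℕ :=
  if i = 1 then (Finset.univ.filter fun x => σ x = x).card
  else Multiset.count i σ.cycleType

/-- Probability of event `E` for a uniformly random permutation of `{1,…,n}` with exactly
`k` cycles. -/
noncomputable def permProb (n k : ℕ) (E : Equiv.Perm (Fin n) → Prop) : ℝ :=
  (Nat.card {σ : Equiv.Perm (Fin n) // numCycles σ = k ∧ E σ} : ℝ) /
    (Nat.card {σ : Equiv.Perm (Fin n) // numCycles σ = k} : ℝ)

open scoped Nat

/-- The product of the factorials of the multiplicities of a multiset. -/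
def multFact (M : Multiset ℕ) : ℕ := ∏ i ∈ M.toFinset, (M.count i)!

/-- The order of the centralizer of a permutation of `Fin n` with cycle type `M`. -/
def typeWeight (n : ℕ) (M : Multiset ℕ) : ℕ := (n - M.sum)! * M.prod * multFact M

theorem multFact_zero : multFact 0 = 1 := by simp [multFact]

theorem multFact_pos (M : Multiset ℕ) : 0 < multFact M :=
  Finset.prod_pos fun _ _ => Nat.factorial_pos _

theorem multFact_cons (a : ℕ) (R : Multiset ℕ) :
    multFact (a ::ₘ R) = (R.count a + 1) * multFact R := by
  have hR : multFact R = ∏ i ∈ insert a R.toFinset, (R.count i)! := by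
    refine Finset.prod_subset (Finset.subset_insert _ _) fun x _ hx => ?_
    rw [Multiset.mem_toFinset] at hx
    simp [Multiset.count_eq_zero_of_notMem hx]
  have ha : a ∈ insert a R.toFinset := Finset.mem_insert_self _ _
  rw [hR, multFact, Multiset.toFinset_cons, ← Finset.mul_prod_erase _ _ ha,
    ← Finset.mul_prod_erase _ _ ha, Multiset.count_cons_self, Nat.factorial_succ, mul_assoc]
  congr 2
  refine Finset.prod_congr rfl fun x hx => ?_
  rw [Multiset.count_cons_of_ne (Finset.ne_of_mem_erase hx)]

theorem multFact_le_cons (a : ℕ) (R : Multiset ℕ) : multFact R ≤ multFact (a ::ₘ R) := by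
  rw [multFact_cons]
  exact Nat.le_mul_of_pos_left _ (Nat.succ_pos _)

theorem multFact_add_replicate_le (R : Multiset ℕ) (a m r : ℕ) (h : R.count a + r ≤ m) :
    multFact (R + Multiset.replicate r a) ≤ m ^ r * multFact R := by
  induction r with
  | zero => simp
  | succ r ih =>
    rw [Multiset.replicate_succ, Multiset.add_cons, multFact_cons, Multiset.count_add,
      Multiset.count_replicate_self, pow_succ', mul_assoc]
    exact Nat.mul_le_mul (by omega) (ih (by omega))

theorem multFact_replicate_add_replicate {a b : ℕ} (hab : a ≠ b) (r s : ℕ) :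
    multFact (Multiset.replicate r a + Multiset.replicate s b) = r ! * s ! := by
  induction s with
  | zero =>
    induction r with
    | zero => simp [multFact_zero]
    | succ r ih =>
      simp only [Multiset.replicate_zero, add_zero, Nat.factorial_zero, mul_one] at ih ⊢
      rw [Multiset.replicate_succ, multFact_cons, ih, Multiset.count_replicate_self,
        Nat.factorial_succ]
  | succ s ih =>
    rw [Multiset.replicate_succ, Multiset.add_cons, multFact_cons, ih, Multiset.count_add,
      Multiset.count_replicate_self, Multiset.count_replicate, if_neg hab, Nat.factorial_succ]
    ring

theorem card_cycleType_mul_typeWeight {n : ℕ} {M : Multiset ℕ} (hs : M.sum ≤ n)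
    (h2 : ∀ a ∈ M, 2 ≤ a) :
    #{g : Equiv.Perm (Fin n) | g.cycleType = M} * typeWeight n M = n ! := by
  have := Equiv.Perm.card_of_cycleType_mul_eq (Fin n) M
  rw [Fintype.card_fin, if_pos ⟨hs, h2⟩] at this
  rw [← this, typeWeight, multFact]

theorem typeWeight_pos {n : ℕ} {M : Multiset ℕ} (h2 : ∀ a ∈ M, 2 ≤ a) : 0 < typeWeight n M := by
  have : 0 < M.prod := Multiset.prod_pos fun a ha => zero_lt_two.trans_le (h2 a ha)
  have := multFact_pos M
  unfold typeWeight
  positivity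

theorem numCycles_eq {n : ℕ} (σ : Equiv.Perm (Fin n)) :
    numCycles σ = σ.cycleType.card + (n - σ.cycleType.sum) := by
  have h := Finset.card_filter_add_card_filter_not (s := (Finset.univ : Finset (Fin n)))
    (fun x => σ x = x)
  have hs : σ.cycleType.sum = #{x | ¬ σ x = x} := by
    rw [Equiv.Perm.sum_cycleType]; rfl
  rw [Finset.card_univ, Fintype.card_fin, ← hs] at h
  unfold numCycles
  omega

theorem two_mul_card_le_sum {M : Multiset ℕ} (h2 : ∀ a ∈ M, 2 ≤ a) : 2 * M.card ≤ M.sum := by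
  simpa [mul_comm] using Multiset.card_nsmul_le_sum h2

/-- Replacing one cycle of length `l` by `l - 1` transpositions. -/
def splitCycle (l : ℕ) (M : Multiset ℕ) : Multiset ℕ :=
  M.erase l + Multiset.replicate (l - 1) 2

theorem card_cycleType_le_splitCycle {n k l : ℕ} {M : Multiset ℕ} (hl : 3 ≤ l) (hlM : l ∈ M)
    (hs : M.sum ≤ n) (h2 : ∀ a ∈ M, 2 ≤ a) (hk : M.card + (n - M.sum) = k)
    (hm : 2 * (n - k) ≤ n) :
    #{g : Equiv.Perm (Fin n) | g.cycleType = M} * (n - 2 * (n - k)) ^ (l - 2) ≤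
      (2 * (n - k)) ^ (l - 1) *
        #{g : Equiv.Perm (Fin n) | g.cycleType = splitCycle l M} := by
  obtain ⟨R, rfl⟩ := Multiset.exists_cons_of_mem hlM
  have hR2 : ∀ a ∈ R, 2 ≤ a := fun a ha => h2 a (Multiset.mem_cons_of_mem ha)
  have hRs := two_mul_card_le_sum hR2
  have hcount := Multiset.count_le_card 2 R
  simp only [splitCycle, Multiset.erase_cons_head]
  simp only [Multiset.sum_cons, Multiset.card_cons] at hs hk
  obtain ⟨e, rfl⟩ : ∃ e, l = e + 2 := ⟨l - 2, by omega⟩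
  set m := n - k with hmdef
  have hs' : (R + Multiset.replicate (e + 2 - 1) 2).sum ≤ n := by
    simp; omega
  have h2' : ∀ a ∈ R + Multiset.replicate (e + 2 - 1) 2, 2 ≤ a := by
    intro a ha
    rcases Multiset.mem_add.1 ha with h | h
    · exact hR2 a h
    · exact (Multiset.eq_of_mem_replicate h).ge
  have hw := card_cycleType_mul_typeWeight (n := n) (M := (e + 2) ::ₘ R) (by simpa using hs) h2
  have hw' := card_cycleType_mul_typeWeight hs' h2'
  have hpos := typeWeight_pos (n := n) h2'
  have key : typeWeight n (R + Multiset.replicate (e + 2 - 1) 2) * (n - 2 * m) ^ e ≤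
      (2 * m) ^ (e + 1) * typeWeight n ((e + 2) ::ₘ R) := by
    have h1 : multFact (R + Multiset.replicate (e + 2 - 1) 2) ≤
        m ^ (e + 1) * multFact ((e + 2) ::ₘ R) :=
      (multFact_add_replicate_le R 2 m (e + 1) (by omega)).trans
        (Nat.mul_le_mul_left _ (multFact_le_cons _ _))
    have h3 : (n - (R.sum + (e + 1) * 2))! * (n - 2 * m) ^ e ≤ (n - (e + 2 + R.sum))! := by
      have he : e ≤ n - (e + 2 + R.sum) := by omega
      rw [← Nat.factorial_mul_descFactorial he]
      have : n - (R.sum + (e + 1) * 2) = n - (e + 2 + R.sum) - e := by omega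
      rw [this]
      refine Nat.mul_le_mul_left _ (le_trans (Nat.pow_le_pow_left ?_ e)
        (Nat.pow_sub_le_descFactorial _ _))
      omega
    simp only [typeWeight, Multiset.sum_add, Multiset.sum_replicate, smul_eq_mul,
      Multiset.prod_add, Multiset.prod_replicate, Multiset.sum_cons, Multiset.prod_cons]
    calc _ = ((n - (R.sum + (e + 1) * 2))! * (n - 2 * m) ^ e) * (R.prod * 2 ^ (e + 1)) *
          multFact (R + Multiset.replicate (e + 2 - 1) 2) := by
          rw [show e + 2 - 1 = e + 1 by omega]; ring
      _ ≤ (n - (e + 2 + R.sum))! * (((e + 2) * R.prod) * 2 ^ (e + 1)) *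
          (m ^ (e + 1) * multFact ((e + 2) ::ₘ R)) := by
          gcongr
          exact Nat.le_mul_of_pos_left _ (by omega)
      _ = _ := by rw [mul_pow]; ring
  refine Nat.le_of_mul_le_mul_right ?_ hpos
  calc _ = #{g : Equiv.Perm (Fin n) | g.cycleType = (e + 2) ::ₘ R} *
        (typeWeight n (R + Multiset.replicate (e + 2 - 1) 2) * (n - 2 * m) ^ e) := by
        rw [show e + 2 - 2 = e by omega]; ring
    _ ≤ #{g : Equiv.Perm (Fin n) | g.cycleType = (e + 2) ::ₘ R} *
        ((2 * m) ^ (e + 1) * typeWeight n ((e + 2) ::ₘ R)) := by gcongr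
    _ = (2 * m) ^ (e + 1) * n ! := by rw [← hw]; ring
    _ = _ := by rw [← hw', show e + 2 - 1 = e + 1 by omega]; ring

theorem card_mem_cycleType_le {n k l : ℕ} (hl : 3 ≤ l) (hm : 2 * (n - k) ≤ n) :
    #{σ : Equiv.Perm (Fin n) | numCycles σ = k ∧ l ∈ σ.cycleType} *
        (n - 2 * (n - k)) ^ (l - 2) ≤
      (2 * (n - k)) ^ (l - 1) * #{σ : Equiv.Perm (Fin n) | numCycles σ = k} := by
  set S : Finset (Equiv.Perm (Fin n)) := {σ | numCycles σ = k ∧ l ∈ σ.cycleType} with hS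
  set I := S.image Equiv.Perm.cycleType with hI
  have hIprop : ∀ M ∈ I, l ∈ M ∧ M.sum ≤ n ∧ (∀ a ∈ M, 2 ≤ a) ∧ M.card + (n - M.sum) = k := by
    intro M hM
    obtain ⟨σ, hσ, rfl⟩ := Finset.mem_image.1 hM
    obtain ⟨h1, h2⟩ := (Finset.mem_filter.1 hσ).2
    refine ⟨h2, ?_, fun a ha => Equiv.Perm.two_le_of_mem_cycleType ha, ?_⟩
    · simpa using σ.sum_cycleType_le
    · rw [← numCycles_eq, h1]
  have hinj : Set.InjOn (splitCycle l) I := by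
    intro M hM N hN h
    have h' := add_right_cancel h
    rw [← Multiset.cons_erase (hIprop M hM).1, ← Multiset.cons_erase (hIprop N hN).1, h']
  rw [Finset.card_eq_sum_card_image Equiv.Perm.cycleType S, Finset.sum_mul]
  calc _ ≤ ∑ M ∈ I, (2 * (n - k)) ^ (l - 1) *
        #{g : Equiv.Perm (Fin n) | g.cycleType = splitCycle l M} := by
        refine Finset.sum_le_sum fun M hM => ?_
        obtain ⟨h1, h2, h3, h4⟩ := hIprop M hM
        refine le_trans (Nat.mul_le_mul_right _ (Finset.card_le_card ?_))
          (card_cycleType_le_splitCycle hl h1 h2 h3 h4 hm)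
        exact Finset.filter_subset_filter _ (Finset.subset_univ _)
    _ = (2 * (n - k)) ^ (l - 1) * ∑ M ∈ I.image (splitCycle l),
        #{g : Equiv.Perm (Fin n) | g.cycleType = M} := by
        rw [Finset.sum_image hinj, Finset.mul_sum]
    _ ≤ _ := by
        gcongr
        rw [← Finset.card_biUnion]
        · refine Finset.card_le_card fun σ hσ => ?_
          obtain ⟨M', hM', hσ⟩ := Finset.mem_biUnion.1 hσ
          obtain ⟨M, hM, rfl⟩ := Finset.mem_image.1 hM'
          obtain ⟨h1, h2, h3, h4⟩ := hIprop M hM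
          obtain ⟨R, rfl⟩ := Multiset.exists_cons_of_mem h1
          have hRs := two_mul_card_le_sum fun a ha => h3 a (Multiset.mem_cons_of_mem ha)
          simp only [splitCycle, Multiset.erase_cons_head, Finset.mem_filter, Finset.mem_univ,
            true_and] at hσ
          simp only [Multiset.sum_cons, Multiset.card_cons] at h2 h4
          simp only [Finset.mem_filter, Finset.mem_univ, true_and, numCycles_eq, hσ,
            Multiset.card_add, Multiset.card_replicate, Multiset.sum_add,
            Multiset.sum_replicate, smul_eq_mul]
          omega
        · intro M _ N _ hMN
          rw [Function.onFun, Finset.disjoint_left]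
          intro σ h1 h2
          exact hMN ((Finset.mem_filter.1 h1).2.symm.trans (Finset.mem_filter.1 h2).2)

/-- The number of permutations of `Fin n` with `k` cycles, all of length at most three, of which
exactly `j` have length three. -/
def shortCount (n k j : ℕ) : ℕ :=
  #{σ : Equiv.Perm (Fin n) |
    numCycles σ = k ∧ (∀ i ∈ σ.cycleType, i ≤ 3) ∧ σ.cycleType.count 3 = j}

theorem eq_replicate_add_replicate {M : Multiset ℕ} (h2 : ∀ a ∈ M, 2 ≤ a)
    (h3 : ∀ a ∈ M, a ≤ 3) :
    M = Multiset.replicate (M.count 2) 2 + Multiset.replicate (M.count 3) 3 := by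
  ext a
  rw [Multiset.count_add, Multiset.count_replicate, Multiset.count_replicate]
  by_cases ha : a ∈ M
  · have := h2 a ha
    have := h3 a ha
    obtain rfl | rfl : a = 2 ∨ a = 3 := by omega
    · simp
    · simp
  · have h0 := Multiset.count_eq_zero_of_notMem ha
    split_ifs with h h' h' <;> subst_vars <;> omega

theorem count_of_shortCount {n k : ℕ} (hk : k ≤ n) {σ : Equiv.Perm (Fin n)}
    (h1 : numCycles σ = k) (h3 : ∀ i ∈ σ.cycleType, i ≤ 3) :
    σ.cycleType.count 2 + 2 * σ.cycleType.count 3 = n - k := by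
  have h := eq_replicate_add_replicate (fun a ha => Equiv.Perm.two_le_of_mem_cycleType ha) h3
  have hs : σ.cycleType.sum ≤ n := by simpa using σ.sum_cycleType_le
  rw [numCycles_eq] at h1
  have hc := congrArg Multiset.card h
  have hsum := congrArg Multiset.sum h
  simp only [Multiset.card_add, Multiset.card_replicate, Multiset.sum_add,
    Multiset.sum_replicate, smul_eq_mul] at hc hsum
  omega

theorem shortCount_eq_zero {n k j : ℕ} (hk : k ≤ n) (hj : n - k < 2 * j) :
    shortCount n k j = 0 := by
  rw [shortCount, Finset.card_eq_zero, Finset.filter_eq_empty_iff]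
  rintro σ - ⟨h1, h3, rfl⟩
  have := count_of_shortCount hk h1 h3
  omega

theorem shortCount_mul {n k j : ℕ} (hk : k ≤ n) (hm : 2 * (n - k) ≤ n) (hj : 2 * j ≤ n - k) :
    shortCount n k j * ((n - 2 * (n - k) + j)! * (2 ^ (n - k - 2 * j) * 3 ^ j) *
      ((n - k - 2 * j)! * j !)) = n ! := by
  set M := Multiset.replicate (n - k - 2 * j) 2 + Multiset.replicate j 3 with hM
  have hsum : M.sum = 2 * (n - k) - j := by simp [hM]; omega
  have h2 : ∀ a ∈ M, 2 ≤ a := by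
    intro a ha
    rcases Multiset.mem_add.1 ha with h | h <;> have := Multiset.eq_of_mem_replicate h <;> omega
  have hset : shortCount n k j = #{g : Equiv.Perm (Fin n) | g.cycleType = M} := by
    unfold shortCount
    congr 1
    ext σ
    simp only [Finset.mem_filter, Finset.mem_univ, true_and]
    constructor
    · rintro ⟨h1, h3, rfl⟩
      have := count_of_shortCount hk h1 h3
      rw [hM, ← this, Nat.add_sub_cancel]
      exact eq_replicate_add_replicate
        (fun a ha => Equiv.Perm.two_le_of_mem_cycleType ha) h3
    · intro h
      refine ⟨?_, ?_, ?_⟩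
      · rw [numCycles_eq, h, hsum]
        simp [hM]; omega
      · rw [h]
        intro a ha
        rcases Multiset.mem_add.1 ha with h | h <;>
          have := Multiset.eq_of_mem_replicate h <;> omega
      · rw [h, hM, Multiset.count_add, Multiset.count_replicate_self, Multiset.count_replicate]
        simp
  have hw : typeWeight n M = (n - 2 * (n - k) + j)! * (2 ^ (n - k - 2 * j) * 3 ^ j) *
      ((n - k - 2 * j)! * j !) := by
    rw [typeWeight, hsum, hM, multFact_replicate_add_replicate (by norm_num), Multiset.prod_add,
      Multiset.prod_replicate, Multiset.prod_replicate]
    congr 4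
    omega
  rw [hset, ← hw]
  exact card_cycleType_mul_typeWeight (by omega) h2

theorem shortCount_zero_pos {n k : ℕ} (hk : k ≤ n) (hm : 2 * (n - k) ≤ n) :
    0 < shortCount n k 0 := by
  have h := shortCount_mul (j := 0) hk hm (by omega)
  exact Nat.pos_of_mul_pos_right (h ▸ Nat.factorial_pos n)

theorem shortCount_ratio {n k : ℕ} (hk : k ≤ n) (hm : 2 * (n - k) ≤ n) (j : ℕ) :
    3 ^ j * j ! * (n - 2 * (n - k) + 1).ascFactorial j * shortCount n k j =
      4 ^ j * (n - k).descFactorial (2 * j) * shortCount n k 0 := by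
  rcases lt_or_ge (n - k) (2 * j) with hj | hj
  · rw [shortCount_eq_zero hk hj, Nat.descFactorial_of_lt hj]
    simp
  have hj' := shortCount_mul hk hm hj
  have h0 := shortCount_mul (j := 0) hk hm (by omega)
  simp only [mul_zero, Nat.sub_zero, add_zero, pow_zero, mul_one, Nat.factorial_zero] at h0
  set m := n - k
  set N := n - 2 * m
  have hX : 0 < N ! * 2 ^ (m - 2 * j) * (m - 2 * j)! := by positivity
  refine Nat.eq_of_mul_eq_mul_right hX ?_
  rw [← Nat.factorial_mul_ascFactorial] at hj'
  rw [← Nat.factorial_mul_descFactorial hj] at h0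
  have hp : 2 ^ m = 2 ^ (m - 2 * j) * 4 ^ j := by
    rw [show (4 : ℕ) = 2 ^ 2 by norm_num, ← pow_mul, ← pow_add]
    congr 1; omega
  rw [hp] at h0
  calc _ = n ! := by rw [← hj']; ring
    _ = _ := by rw [← h0]; ring

/-- The number of permutations of `Fin n` with `k` cycles. -/
def totalCount (n k : ℕ) : ℕ := #{σ : Equiv.Perm (Fin n) | numCycles σ = k}

/-- The number of permutations of `Fin n` with `k` cycles having a cycle of length at least
four. -/
def longCount (n k : ℕ) : ℕ :=
  #{σ : Equiv.Perm (Fin n) | numCycles σ = k ∧ ¬ ∀ i ∈ σ.cycleType, i ≤ 3}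

theorem longCount_le {n k : ℕ} (hn : 0 < n) (hm : 6 * (n - k) ≤ n) :
    (longCount n k : ℝ) ≤
      2 * (2 * (n - k : ℕ)) ^ 3 / ((n - 2 * (n - k) : ℕ) : ℝ) ^ 2 * totalCount n k := by
  have hunion : longCount n k ≤ ∑ e ∈ range n,
      #{σ : Equiv.Perm (Fin n) | numCycles σ = k ∧ e + 4 ∈ σ.cycleType} := by
    refine le_trans (Finset.card_le_card fun σ hσ => ?_) Finset.card_biUnion_le
    simp only [Finset.mem_filter, Finset.mem_univ, true_and, not_forall, Finset.mem_biUnion,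
      Finset.mem_range] at hσ ⊢
    obtain ⟨h1, l, hl, h4⟩ := hσ
    have hle := Multiset.le_sum_of_mem hl
    have hs : σ.cycleType.sum ≤ n := by simpa using σ.sum_cycleType_le
    refine ⟨l - 4, by omega, h1, ?_⟩
    rwa [Nat.sub_add_cancel (by omega)]
  set m := n - k
  have hN : 0 < n - 2 * m := by omega
  have hNR : (0 : ℝ) < (n - 2 * m : ℕ) := by exact_mod_cast hN
  have hq : (2 * m : ℝ) / (n - 2 * m : ℕ) ≤ 1 / 2 := by
    rw [div_le_div_iff₀ hNR two_pos]
    have : 2 * m * 2 ≤ 1 * (n - 2 * m) := by omega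
    exact_mod_cast this
  have hterm : ∀ e, (#{σ : Equiv.Perm (Fin n) | numCycles σ = k ∧ e + 4 ∈ σ.cycleType} : ℝ) ≤
      (1 / 2) ^ e * ((2 * m) ^ 3 / ((n - 2 * m : ℕ) : ℝ) ^ 2 * totalCount n k) := by
    intro e
    have h := card_mem_cycleType_le (n := n) (k := k) (l := e + 4) (by omega) (by omega)
    have h' : (#{σ : Equiv.Perm (Fin n) | numCycles σ = k ∧ e + 4 ∈ σ.cycleType} : ℝ) *
        ((n - 2 * m : ℕ) : ℝ) ^ (e + 2) ≤ (2 * m) ^ (e + 3) * totalCount n k := by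
      exact_mod_cast h
    rw [← le_div_iff₀ (by positivity)] at h'
    refine h'.trans ?_
    calc _ = ((2 * m : ℝ) / (n - 2 * m : ℕ)) ^ e *
          ((2 * m) ^ 3 / ((n - 2 * m : ℕ) : ℝ) ^ 2 * totalCount n k) := by
          rw [div_pow, pow_add _ e 3, pow_add _ e 2]
          ring
      _ ≤ _ := by gcongr
  calc (longCount n k : ℝ) ≤ ∑ e ∈ range n,
        (#{σ : Equiv.Perm (Fin n) | numCycles σ = k ∧ e + 4 ∈ σ.cycleType} : ℝ) := by
        exact_mod_cast hunion
    _ ≤ ∑ e ∈ range n,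
        (1 / 2 : ℝ) ^ e * ((2 * m) ^ 3 / ((n - 2 * m : ℕ) : ℝ) ^ 2 * totalCount n k) :=
        Finset.sum_le_sum fun e _ => hterm e
    _ ≤ 2 * ((2 * m) ^ 3 / ((n - 2 * m : ℕ) : ℝ) ^ 2 * totalCount n k) := by
        rw [← Finset.sum_mul]
        gcongr
        exact sum_geometric_two_le n
    _ = _ := by ring

theorem sum_shortCount_add_longCount {n k : ℕ} (hk : k ≤ n) :
    ∑ j ∈ range (n + 1), shortCount n k j + longCount n k = totalCount n k := by
  have h : ∑ j ∈ range (n + 1), shortCount n k j =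
      #{σ : Equiv.Perm (Fin n) | numCycles σ = k ∧ ∀ i ∈ σ.cycleType, i ≤ 3} := by
    rw [Finset.card_eq_sum_card_fiberwise (f := fun σ => σ.cycleType.count 3)
      (t := range (n + 1))]
    · refine Finset.sum_congr rfl fun j _ => ?_
      rw [shortCount, Finset.filter_filter]
      simp only [and_assoc]
    · intro σ hσ
      have hσ := (Finset.mem_filter.1 hσ).2
      have := count_of_shortCount hk hσ.1 hσ.2
      simp only [Finset.coe_range, Set.mem_Iio]
      omega
  rw [h, longCount, totalCount, ← Finset.filter_filter, ← Finset.filter_filter]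
  exact Finset.card_filter_add_card_filter_not _

theorem tsum_shortCount {n k : ℕ} (hk : k ≤ n) (c : ℝ) :
    ∑' j, (shortCount n k j : ℝ) / c = ((totalCount n k : ℝ) - longCount n k) / c := by
  rw [tsum_eq_sum (s := range (n + 1)), ← Finset.sum_div, ← sum_shortCount_add_longCount hk]
  · push_cast
    ring
  · intro j hj
    rw [Finset.mem_range] at hj
    rw [shortCount_eq_zero hk (by omega)]
    simp

theorem shortCount_div {n k : ℕ} (hk : k ≤ n) (hm : 2 * (n - k) ≤ n) (j : ℕ) :
    (shortCount n k j : ℝ) / shortCount n k 0 =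
      (4 / 3) ^ j * (((n - k).descFactorial (2 * j) : ℝ) /
        (n - 2 * (n - k) + 1).ascFactorial j) / j ! := by
  have h : (3 : ℝ) ^ j * j ! * (n - 2 * (n - k) + 1).ascFactorial j * shortCount n k j =
      4 ^ j * (n - k).descFactorial (2 * j) * shortCount n k 0 := by
    exact_mod_cast shortCount_ratio hk hm j
  have h0 : (shortCount n k 0 : ℝ) ≠ 0 := by exact_mod_cast (shortCount_zero_pos hk hm).ne'
  have h1 : ((n - 2 * (n - k) + 1).ascFactorial j : ℝ) ≠ 0 := by
    exact_mod_cast (Nat.ascFactorial_pos _ _).ne'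
  have h2 : (j ! : ℝ) ≠ 0 := by exact_mod_cast Nat.factorial_ne_zero j
  rw [div_pow, div_eq_iff h0]
  field_simp
  linarith

theorem shortCount_div_le {n k : ℕ} (hk : k ≤ n) (hm : 2 * (n - k) < n) {c : ℝ}
    (hc : ((n - k : ℕ) : ℝ) ^ 2 / (n - 2 * (n - k) : ℕ) ≤ c) (j : ℕ) :
    (shortCount n k j : ℝ) / shortCount n k 0 ≤ (4 / 3 * c) ^ j / j ! := by
  rw [shortCount_div hk hm.le, mul_pow]
  have hN : (0 : ℝ) < (n - 2 * (n - k) : ℕ) := by exact_mod_cast (by omega)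
  gcongr
  refine le_trans ?_ (pow_le_pow_left₀ (by positivity) hc j)
  rw [div_pow, ← pow_mul]
  gcongr
  · exact_mod_cast Nat.descFactorial_le_pow _ _
  · exact_mod_cast (Nat.pow_le_pow_left (Nat.le_succ _) j).trans (Nat.pow_succ_le_ascFactorial _ _)

section Asymptotics

variable {t : ℝ} {m : ℕ → ℕ}

theorem tendsto_inv_sqrt_natCast :
    Tendsto (fun n : ℕ => (Real.sqrt n)⁻¹) atTop (nhds 0) :=
  tendsto_inv_atTop_zero.comp (Real.tendsto_sqrt_atTop.comp tendsto_natCast_atTop_atTop)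

theorem tendsto_div_natCast (hlim : Tendsto (fun n : ℕ => (m n : ℝ) / Real.sqrt n) atTop (nhds t)) :
    Tendsto (fun n : ℕ => (m n : ℝ) / n) atTop (nhds 0) := by
  have h := hlim.mul tendsto_inv_sqrt_natCast
  rw [mul_zero] at h
  refine h.congr fun n => ?_
  rw [← div_eq_mul_inv, div_div, Real.mul_self_sqrt (Nat.cast_nonneg n)]

theorem eventually_mul_lt (hlim : Tendsto (fun n : ℕ => (m n : ℝ) / Real.sqrt n) atTop (nhds t))
    (c : ℕ) : ∀ᶠ n in atTop, c * m n < n := by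
  have h := (tendsto_div_natCast hlim).const_mul (c : ℝ)
  rw [mul_zero] at h
  filter_upwards [h.eventually_lt_const one_pos, eventually_gt_atTop 0] with n hn h0
  have h0' : (0 : ℝ) < n := by exact_mod_cast h0
  rw [← mul_div_assoc, div_lt_one h0'] at hn
  exact_mod_cast hn

theorem eventually_gt_of_tendsto (ht : 0 < t)
    (hlim : Tendsto (fun n : ℕ => (m n : ℝ) / Real.sqrt n) atTop (nhds t)) (c : ℕ) :
    ∀ᶠ n in atTop, c < m n := by
  have h := hlim.pos_mul_atTop ht
    (Real.tendsto_sqrt_atTop.comp tendsto_natCast_atTop_atTop)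
  filter_upwards [h.eventually_gt_atTop (c : ℝ), eventually_gt_atTop 0] with n hn h0
  have h0' : (0 : ℝ) < Real.sqrt n := Real.sqrt_pos.2 (by exact_mod_cast h0)
  simp only [Function.comp_apply] at hn
  rw [div_mul_cancel₀ _ h0'.ne'] at hn
  exact_mod_cast hn

theorem tendsto_sub_const_div_sqrt (ht : 0 < t)
    (hlim : Tendsto (fun n : ℕ => (m n : ℝ) / Real.sqrt n) atTop (nhds t)) (c : ℕ) :
    Tendsto (fun n : ℕ => ((m n - c : ℕ) : ℝ) / Real.sqrt n) atTop (nhds t) := by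
  have h := hlim.sub (tendsto_inv_sqrt_natCast.const_mul (c : ℝ))
  rw [mul_zero, sub_zero] at h
  refine h.congr' ?_
  filter_upwards [eventually_gt_of_tendsto ht hlim c] with n hn
  rw [Nat.cast_sub hn.le, sub_div, div_eq_mul_inv (c : ℝ)]

theorem tendsto_sub_two_mul_add_div
    (hlim : Tendsto (fun n : ℕ => (m n : ℝ) / Real.sqrt n) atTop (nhds t)) (c : ℕ) :
    Tendsto (fun n : ℕ => ((n - 2 * m n + c : ℕ) : ℝ) / n) atTop (nhds 1) := by
  have h := ((tendsto_const_nhds (x := (1 : ℝ))).sub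
    ((tendsto_div_natCast hlim).const_mul 2)).add (tendsto_const_div_atTop_nhds_zero_nat (c : ℝ))
  rw [mul_zero, sub_zero, add_zero] at h
  refine h.congr' ?_
  filter_upwards [eventually_mul_lt hlim 2, eventually_gt_atTop 0] with n hn h0
  have h0' : (n : ℝ) ≠ 0 := by exact_mod_cast h0.ne'
  rw [Nat.cast_add, Nat.cast_sub hn.le]
  push_cast
  field_simp

theorem tendsto_descFactorial_div_ascFactorial (ht : 0 < t)
    (hlim : Tendsto (fun n : ℕ => (m n : ℝ) / Real.sqrt n) atTop (nhds t)) (j : ℕ) :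
    Tendsto (fun n : ℕ => ((m n).descFactorial (2 * j) : ℝ) /
      (n - 2 * m n + 1).ascFactorial j) atTop (nhds ((t ^ 2) ^ j)) := by
  induction j with
  | zero => simp
  | succ j ih =>
    have h := (((tendsto_sub_const_div_sqrt ht hlim (2 * j + 1)).mul
      (tendsto_sub_const_div_sqrt ht hlim (2 * j))).div
      (tendsto_sub_two_mul_add_div hlim (1 + j)) one_ne_zero).mul ih
    rw [div_one, ← pow_two, ← pow_succ'] at h
    refine h.congr' ?_
    filter_upwards [eventually_gt_atTop 0] with n h0
    have h0' : (0 : ℝ) < n := by exact_mod_cast h0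
    simp only [Pi.div_apply]
    rw [show 2 * (j + 1) = 2 * j + 1 + 1 by ring, Nat.descFactorial_succ, Nat.descFactorial_succ,
      Nat.ascFactorial_succ, ← add_assoc, div_mul_div_comm _ (Real.sqrt n), Real.mul_self_sqrt h0'.le,
      div_div_div_cancel_right₀ h0'.ne', div_mul_div_comm]
    push_cast
    ring

theorem tendsto_sq_div
    (hlim : Tendsto (fun n : ℕ => (m n : ℝ) / Real.sqrt n) atTop (nhds t)) :
    Tendsto (fun n : ℕ => (m n : ℝ) ^ 2 / (n - 2 * m n : ℕ)) atTop (nhds (t ^ 2)) := by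
  have h := (hlim.pow 2).div (tendsto_sub_two_mul_add_div hlim 0) one_ne_zero
  rw [div_one] at h
  refine h.congr' ?_
  filter_upwards [eventually_gt_atTop 0] with n h0
  have h0' : (0 : ℝ) < n := by exact_mod_cast h0
  rw [Pi.div_apply, div_pow, Real.sq_sqrt h0'.le, div_div_div_cancel_right₀ h0'.ne', add_zero]

theorem tendsto_cube_div
    (hlim : Tendsto (fun n : ℕ => (m n : ℝ) / Real.sqrt n) atTop (nhds t)) :
    Tendsto (fun n : ℕ => 2 * (2 * (m n : ℝ)) ^ 3 / ((n - 2 * m n : ℕ) : ℝ) ^ 2) atTop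
      (nhds 0) := by
  have h := (((tendsto_sq_div hlim).mul (tendsto_div_natCast hlim)).div
    (tendsto_sub_two_mul_add_div hlim 0) one_ne_zero).const_mul 16
  rw [mul_zero, zero_div, mul_zero] at h
  refine h.congr' ?_
  filter_upwards [eventually_gt_atTop 0] with n h0
  have h0' : (n : ℝ) ≠ 0 := by exact_mod_cast h0.ne'
  rw [Pi.div_apply, mul_div_assoc' _ _ (n : ℝ), div_div_div_cancel_right₀ h0', add_zero]
  ring

end Asymptotics

section Limits

variable {t : ℝ} {k : ℕ → ℕ}

theorem eventually_excess_bounds (ht : 0 < t)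
    (hlim : Tendsto (fun n : ℕ => ((n - k n : ℕ) : ℝ) / Real.sqrt n) atTop (nhds t)) :
    ∀ᶠ n in atTop, 0 < n ∧ k n ≤ n ∧ 6 * (n - k n) < n := by
  filter_upwards [eventually_gt_of_tendsto (m := fun n => n - k n) ht hlim 0,
    eventually_mul_lt (m := fun n => n - k n) hlim 6] with n h1 h2
  omega

theorem totalCount_pos {n k : ℕ} (hk : k ≤ n) (hm : 2 * (n - k) ≤ n) : 0 < totalCount n k := by
  refine (shortCount_zero_pos hk hm).trans_le (Finset.card_le_card ?_)
  exact Finset.monotone_filter_right _ fun σ _ h => h.1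

theorem tendsto_longCount_div_totalCount (ht : 0 < t)
    (hlim : Tendsto (fun n : ℕ => ((n - k n : ℕ) : ℝ) / Real.sqrt n) atTop (nhds t)) :
    Tendsto (fun n => (longCount n (k n) : ℝ) / totalCount n (k n)) atTop (nhds 0) := by
  refine squeeze_zero' (Eventually.of_forall fun n => by positivity) ?_
    (tendsto_cube_div (m := fun n => n - k n) hlim)
  filter_upwards [eventually_excess_bounds ht hlim] with n ⟨h0, hk, hm⟩
  have : (0 : ℝ) < totalCount n (k n) := by exact_mod_cast totalCount_pos hk (by omega)
  rw [div_le_iff₀ this]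
  exact longCount_le h0 hm.le

theorem tendsto_shortCount_div (ht : 0 < t)
    (hlim : Tendsto (fun n : ℕ => ((n - k n : ℕ) : ℝ) / Real.sqrt n) atTop (nhds t)) (j : ℕ) :
    Tendsto (fun n => (shortCount n (k n) j : ℝ) / shortCount n (k n) 0) atTop
      (nhds ((4 / 3 * t ^ 2) ^ j / j !)) := by
  have h := ((tendsto_descFactorial_div_ascFactorial (m := fun n => n - k n) ht hlim j).const_mul
    ((4 / 3 : ℝ) ^ j)).div_const (j ! : ℝ)
  rw [← mul_pow] at h
  refine h.congr' ?_
  filter_upwards [eventually_excess_bounds ht hlim] with n ⟨h0, hk, hm⟩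
  rw [shortCount_div hk (by omega)]

theorem tendsto_tsum_shortCount_div (ht : 0 < t)
    (hlim : Tendsto (fun n : ℕ => ((n - k n : ℕ) : ℝ) / Real.sqrt n) atTop (nhds t)) :
    Tendsto (fun n => ∑' j, (shortCount n (k n) j : ℝ) / shortCount n (k n) 0) atTop
      (nhds (Real.exp (4 / 3 * t ^ 2))) := by
  rw [Real.exp_eq_exp_ℝ, NormedSpace.exp_eq_tsum_div]
  refine tendsto_tsum_of_dominated_convergence
    (Real.summable_pow_div_factorial (4 / 3 * (t ^ 2 + 1)))
    (tendsto_shortCount_div ht hlim) ?_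
  filter_upwards [eventually_excess_bounds ht hlim,
    (tendsto_sq_div (m := fun n => n - k n) hlim).eventually_le_const
      (lt_add_one (t ^ 2))] with n ⟨h0, hk, hm⟩ hc j
  rw [Real.norm_of_nonneg (by positivity)]
  exact shortCount_div_le hk (by omega) hc j

theorem tendsto_shortCount_div_totalCount (ht : 0 < t)
    (hlim : Tendsto (fun n : ℕ => ((n - k n : ℕ) : ℝ) / Real.sqrt n) atTop (nhds t)) (j : ℕ) :
    Tendsto (fun n => (shortCount n (k n) j : ℝ) / totalCount n (k n)) atTop
      (nhds (Real.exp (-(4 / 3 * t ^ 2)) * (4 / 3 * t ^ 2) ^ j / j !)) := by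
  have h := ((tendsto_shortCount_div ht hlim j).div (tendsto_tsum_shortCount_div ht hlim)
    (Real.exp_ne_zero _)).mul ((tendsto_const_nhds (x := (1 : ℝ))).sub
      (tendsto_longCount_div_totalCount ht hlim))
  have hval : (4 / 3 * t ^ 2) ^ j / (j ! : ℝ) / Real.exp (4 / 3 * t ^ 2) * (1 - 0) =
      Real.exp (-(4 / 3 * t ^ 2)) * (4 / 3 * t ^ 2) ^ j / j ! := by
    rw [Real.exp_neg]
    ring
  rw [hval] at h
  refine h.congr' ?_
  filter_upwards [eventually_excess_bounds ht hlim] with n ⟨h0, hk, hm⟩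
  have hT : (totalCount n (k n) : ℝ) ≠ 0 := by
    exact_mod_cast (totalCount_pos hk (by omega)).ne'
  have hS : (shortCount n (k n) 0 : ℝ) ≠ 0 := by
    exact_mod_cast (shortCount_zero_pos hk (by omega)).ne'
  have hG : (totalCount n (k n) : ℝ) - longCount n (k n) ≠ 0 := by
    have hpos := shortCount_zero_pos hk (by omega : 2 * (n - k n) ≤ n)
    have hle : shortCount n (k n) 0 ≤ ∑ j ∈ range (n + 1), shortCount n (k n) j :=
      Finset.single_le_sum (fun _ _ => Nat.zero_le _) (Finset.mem_range.2 n.succ_pos)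
    rw [← sum_shortCount_add_longCount hk, Nat.cast_add, add_sub_cancel_right]
    exact_mod_cast (hpos.trans_le hle).ne'
  rw [Pi.div_apply, tsum_shortCount hk, div_div_div_cancel_right₀ hS, one_sub_div hT,
    div_mul_div_cancel₀ hG]

end Limits

theorem permProb_eq (n k : ℕ) (E : Equiv.Perm (Fin n) → Prop) [DecidablePred E] :
    permProb n k E =
      (#{σ : Equiv.Perm (Fin n) | numCycles σ = k ∧ E σ} : ℝ) / totalCount n k := by
  rw [permProb, Nat.card_eq_fintype_card, Nat.card_eq_fintype_card, Fintype.card_subtype,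
    Fintype.card_subtype, totalCount]

/-- let `t > 0` and `k(n)` be an increasing sequence of positive integers with
`(n − k(n))/√n → t`, and let `C_i` be the number of cycles of length `i` in a uniformly random
permutation of `{1,…,n}` with exactly `k(n)` cycles. Then `C_3` converges in distribution to
Poisson with mean `(4/3)t²` (pointwise convergence of the probability mass function), and
with high probability all other cycles have length one or two:
`P(C_i = 0 for all i ≥ 4) → 1`. -/
theorem permutation_small_cycles (t : ℝ) (ht : 0 < t) (k : ℕ → ℕ)
    (hmono : Monotone k) (hpos : ∀ n, 0 < k n)
    (hlim : Tendsto (fun n : ℕ => ((n - k n : ℕ) : ℝ) / Real.sqrt n) atTop (nhds t)) :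
    (∀ j : ℕ, Tendsto (fun n : ℕ => permProb n (k n) (fun σ => cycleCount σ 3 = j))
        atTop (nhds (ProbabilityTheory.poissonPMFReal (Real.toNNReal ((4/3) * t ^ 2)) j))) ∧
    Tendsto (fun n : ℕ => permProb n (k n) (fun σ => ∀ i, 4 ≤ i → cycleCount σ i = 0))
        atTop (nhds 1) := by
  refine ⟨fun j => ?_, ?_⟩
  · have hr : 0 ≤ 4 / 3 * t ^ 2 := by positivity
    rw [ProbabilityTheory.poissonPMFReal, Real.coe_toNNReal _ hr]
    have h1 := tendsto_shortCount_div_totalCount ht hlim j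
    have h2 := h1.add (tendsto_longCount_div_totalCount ht hlim)
    rw [add_zero] at h2
    refine tendsto_of_tendsto_of_tendsto_of_le_of_le h1 h2 (fun n => ?_) fun n => ?_
    · simp only [permProb_eq, shortCount]
      refine div_le_div_of_nonneg_right (Nat.cast_le.2 ?_) (Nat.cast_nonneg _)
      refine Finset.card_le_card fun σ hσ => ?_
      obtain ⟨h, -, h3⟩ := (Finset.mem_filter.1 hσ).2
      refine Finset.mem_filter.2 ⟨Finset.mem_univ _, ?_⟩
      exact ⟨h, by simpa [cycleCount] using h3⟩
    · simp only [permProb_eq, ← add_div]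
      gcongr
      rw [shortCount, longCount]
      norm_cast
      refine le_trans (Finset.card_le_card fun σ hσ => ?_) (Finset.card_union_le _ _)
      obtain ⟨h, h3⟩ := (Finset.mem_filter.1 hσ).2
      have h3 : σ.cycleType.count 3 = j := by simpa [cycleCount] using h3
      simp only [Finset.mem_union, Finset.mem_filter, Finset.mem_univ, true_and]
      tauto
  · have h := (tendsto_const_nhds (x := (1 : ℝ))).sub (tendsto_longCount_div_totalCount ht hlim)
    rw [sub_zero] at h
    refine h.congr' ?_
    filter_upwards [eventually_excess_bounds ht hlim] with n ⟨h0, hk, hm⟩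
    classical
    have hT : (totalCount n (k n) : ℝ) ≠ 0 := by
      exact_mod_cast (totalCount_pos hk (by omega)).ne'
    rw [permProb_eq, one_sub_div hT]
    congr 1
    rw [sub_eq_iff_eq_add]
    norm_cast
    rw [totalCount, longCount, ← Finset.card_filter_add_card_filter_not
      (s := {σ : Equiv.Perm (Fin n) | numCycles σ = k n}) (fun σ => ∀ i ∈ σ.cycleType, i ≤ 3),
      Finset.filter_filter, Finset.filter_filter]
    congr 2
    ext σ
    simp only [Finset.mem_filter, Finset.mem_univ, true_and]
    refine and_congr_right fun _ => ⟨fun h i hi => ?_, fun h i hi => ?_⟩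
    · rw [cycleCount, if_neg (by omega), Multiset.count_eq_zero]
      exact fun hmem => absurd (h i hmem) (by omega)
    · by_contra hlt
      have := h i (by omega)
      rw [cycleCount, if_neg (by omega), Multiset.count_eq_zero] at this
      exact this hi
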